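/- Let G = R(m;a,b,c) be a connected generalized rose window graph (m ≥ 3, a, b, c ∈ ZMod m nonzero, 2a ≠ 0, 2b ≠ 0, gcd(m,a,b,c) = 1). Let H be the spanning subgraph of G obtained by deleting all spokes of type c (the edges u_i v_{i+c}, i ∈ ZMod m), and let H_0 denote the induced subgraph of H on the connected component of H containing the vertex u_0. Suppose gcd(m,a,b) > 1 (gcd of m with the canonical integer representatives of a and b). If H_0 is Hamiltonian and there exists x ∈ ZMod m with u_x a vertex of H_0 such that H_0 contains a Hamilton path with endpoints v_x and v_{x+a}, or a Hamilton path with endpoints u_x and u_{x+b} (i.e., H_0 has a 2-hooked Hamilton cycle), then G is Hamiltonian. -/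

import Mathlib

open SimpleGraph

/-- The bicirculant graph `B(m;R,S,T)` on vertex set `ZMod m ⊕ ZMod m`. -/
def bicirculant (m : ℕ) (R S T : Set (ZMod m)) : SimpleGraph (ZMod m ⊕ ZMod m) :=
  SimpleGraph.fromRel (fun x y =>
    match x, y with
    | Sum.inl i, Sum.inl i' => ∃ j ∈ R, i' = i + j
    | Sum.inr i, Sum.inr i' => ∃ j ∈ T, i' = i + j
    | Sum.inl i, Sum.inr i' => ∃ j ∈ S, i' = i + j
    | Sum.inr _, Sum.inl _ => False)

/-- The generalized rose window graph `R(m;a,b,c) = B(m;{a,-a},{0,c},{b,-b})`. -/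
def roseWindow (m : ℕ) (a b c : ZMod m) : SimpleGraph (ZMod m ⊕ ZMod m) :=
  bicirculant m {a, -a} {0, c} {b, -b}

/-- `H`: the spanning subgraph of `R(m;a,b,c)` obtained by deleting the spokes of
type `c`, i.e. all edges `u_i v_{i+c}`. -/
def rwH (m : ℕ) (a b c : ZMod m) : SimpleGraph (ZMod m ⊕ ZMod m) :=
  (roseWindow m a b c).deleteEdges
    {e | ∃ i : ZMod m, e = s(Sum.inl i, Sum.inr (i + c))}

/-- The vertex set of the connected component of `H` containing `u_0`. -/
def rwK (m : ℕ) (a b c : ZMod m) : Set (ZMod m ⊕ ZMod m) :=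
  ((rwH m a b c).connectedComponentMk (Sum.inl 0)).supp

/-- `H_0`: the induced subgraph of `H` on the connected component of `u_0`. -/
def rwH0 (m : ℕ) (a b c : ZMod m) : SimpleGraph (rwK m a b c) :=
  (rwH m a b c).induce (rwK m a b c)

namespace SimpleGraph.Walk

variable {V : Type*} {G : SimpleGraph V}

/-- The support of a walk obtained by joining two walks by an edge. -/
lemma support_append_cons {s x y t : V} (p : G.Walk s x) (h : G.Adj x y) (q : G.Walk y t) :
    (p.append (cons h q)).support = p.support ++ q.support := by
  simp [support_append]

/-- Suppose each vertex satisfying `col` has at most one neighbour violating `col`. Then a path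
through a vertex satisfying `col`, both of whose ends violate `col`, uses an edge both of whose
ends satisfy `col`. -/
lemma IsPath.exists_split_of_col [DecidableEq V] {col : V → Prop}
    (huniq : ∀ x y z, col x → G.Adj x y → G.Adj x z → ¬ col y → ¬ col z → y = z)
    {s t x : V} {p : G.Walk s t} (hp : p.IsPath) (hx : x ∈ p.support) (hcol : col x)
    (hs : ¬ col s) (ht : ¬ col t) :
    ∃ x' y' : V, col x' ∧ col y' ∧ G.Adj x' y' ∧ ∃ (A : G.Walk s x') (B : G.Walk y' t),
      p.support = A.support ++ B.support := by
  obtain ⟨A, B, rfl⟩ : ∃ (A : G.Walk s x) (B : G.Walk x t), p = A.append B :=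
    ⟨p.takeUntil x hx, p.dropUntil x hx, (p.take_spec hx).symm⟩
  obtain ⟨A, rfl⟩ : ∃ A' : G.Walk x s, A = A'.reverse := ⟨A.reverse, by simp⟩
  cases A with
  | nil => exact absurd hcol hs
  | @cons _ y _ h A =>
    cases B with
    | nil => exact absurd hcol ht
    | @cons _ z _ h' B =>
      by_cases hy : col y
      · exact ⟨y, x, hy, hcol, h.symm, A.reverse, cons h' B, by simp [support_append]⟩
      by_cases hz : col z
      · exact ⟨x, z, hcol, hz, h', (cons h A).reverse, B, by simp [support_append]⟩
      obtain rfl := huniq x y z hcol h h' hy hz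
      rw [isPath_def] at hp
      simp only [reverse_cons, support_append, support_reverse, support_cons,
        List.tail_cons, List.nodup_append] at hp
      exact absurd rfl (hp.2.2 y (by simp) y (by simp))

/-- Suppose each vertex satisfying `col` has at most one neighbour violating `col`. Then a cycle
through a vertex satisfying `col` can be opened up at an edge both of whose ends satisfy `col`. -/
lemma IsCycle.exists_isPath_of_col {col : V → Prop}
    (huniq : ∀ x y z, col x → G.Adj x y → G.Adj x z → ¬ col y → ¬ col z → y = z)
    {x : V} {p : G.Walk x x} (hp : p.IsCycle) (hcol : col x) :
    ∃ y, col y ∧ G.Adj x y ∧ ∃ q : G.Walk y x, q.IsPath ∧ ∀ z, z ∈ q.support ↔ z ∈ p.support := by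
  have key : ∀ r : G.Walk x x, r.IsCycle → col r.snd →
      ∃ y, col y ∧ G.Adj x y ∧
        ∃ q : G.Walk y x, q.IsPath ∧ ∀ z, z ∈ q.support ↔ z ∈ r.support := by
    intro r hr hc
    refine ⟨r.snd, hc, r.adj_snd hr.not_nil, r.tail, hr.isPath_tail, fun z => ?_⟩
    rw [← r.cons_support_tail hr.not_nil, List.mem_cons]
    refine ⟨Or.inr, ?_⟩
    rintro (rfl | h)
    · exact end_mem_support _
    · exact h
  by_cases h1 : col p.snd
  · exact key p hp h1
  by_cases h2 : col p.penultimate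
  · simpa using key p.reverse hp.reverse (by simpa using h2)
  · exact absurd (huniq _ _ _ hcol (p.adj_snd hp.not_nil) (p.adj_penultimate hp.not_nil).symm h1 h2)
      hp.snd_ne_penultimate

/-- A Hamilton path with adjacent ends closes up to a Hamilton cycle. -/
lemma IsPath.isHamiltonian_of_adj [Fintype V] [DecidableEq V] (hV : 3 ≤ Fintype.card V) {x y : V}
    {p : G.Walk y x} (hp : p.IsPath) (hmem : ∀ z, z ∈ p.support) (h : G.Adj x y) :
    G.IsHamiltonian := by
  intro _
  have hlen := (hp.isHamiltonian_of_mem hmem).length_eq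
  have hl : (cons h p).length = Fintype.card V := by
    rw [length_cons]; omega
  refine ⟨x, cons h p, isHamiltonianCycle_iff_isCycle_and_length_eq.2 ⟨?_, hl⟩⟩
  refine isCycle_iff_isPath_tail_and_le_length.2 ⟨?_, by omega⟩
  simpa using hp

end SimpleGraph.Walk

/-- Gluing along hooks. The fibres of `lab` are cyclically ordered by adding `q`; the fibre over `0`
carries a cycle of `H`, and any edge of `H` between two vertices satisfying `col` can be replaced
in `G` by a detour through all of the next fibre. Then `G` is Hamiltonian. -/
theorem SimpleGraph.isHamiltonian_of_hooks {V Q : Type*} [Fintype V] [DecidableEq V]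
    [AddCommGroup Q] [Finite Q] (hV : 3 ≤ Fintype.card V) {G H : SimpleGraph V} (hle : H ≤ G)
    {col : V → Prop} {lab : V → Q} {q : Q} (hq : ∀ g : Q, g ∈ AddSubgroup.zmultiples q)
    (huniq : ∀ x y z, col x → H.Adj x y → H.Adj x z → ¬ col y → ¬ col z → y = z)
    (hex : ∀ g, ∃ x, col x ∧ lab x = g)
    (hcyc : ∃ x, col x ∧ ∃ p : H.Walk x x, p.IsCycle ∧ ∀ z, z ∈ p.support ↔ lab z = 0)
    (hhook : ∀ x y, col x → col y → H.Adj x y → ∃ w w', ¬ col w ∧ ¬ col w' ∧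
      G.Adj x w ∧ G.Adj y w' ∧
      ∃ p : H.Walk w w', p.IsPath ∧ ∀ z, z ∈ p.support ↔ lab z = lab x + q) :
    G.IsHamiltonian := by
  have main : ∀ k < addOrderOf q, ∃ x y, col x ∧ col y ∧ H.Adj x y ∧ lab x = k • q ∧
      ∃ p : G.Walk y x, p.IsPath ∧ ∀ z, z ∈ p.support ↔ ∃ j ≤ k, lab z = j • q := by
    intro k
    induction k with
    | zero =>
      intro _
      obtain ⟨x, hx, c, hc, hcs⟩ := hcyc
      obtain ⟨y, hy, hxy, p, hp, hps⟩ := hc.exists_isPath_of_col huniq hx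
      refine ⟨x, y, hx, hy, hxy, ?_, p.mapLe hle, hp.mapLe hle, fun z => ?_⟩
      · simpa using (hcs x).1 c.start_mem_support
      · simp [hps, hcs]
    | succ k ih =>
      intro hk
      obtain ⟨x, y, hx, hy, hxy, hlab, p, hp, hps⟩ := ih (by omega)
      obtain ⟨w, w', hw, hw', hxw, hyw, r, hr, hrs⟩ := hhook x y hx hy hxy
      have hnext : lab x + q = (k + 1) • q := by rw [hlab, succ_nsmul]
      simp only [hnext] at hrs
      obtain ⟨u, hu, hul⟩ := hex ((k + 1) • q)
      obtain ⟨x', y', hx', hy', hxy', A, B, hAB⟩ :=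
        hr.exists_split_of_col huniq ((hrs u).2 hul) hu hw hw'
      have hdisj : ∀ z, z ∈ p.support → z ∉ r.support := by
        intro z hz hz'
        obtain ⟨j, hj, hjz⟩ := (hps z).1 hz
        have := nsmul_injOn_Iio_addOrderOf (show j < addOrderOf q by omega) hk
          (hjz.symm.trans ((hrs z).1 hz'))
        omega
      have hsup : ((B.mapLe hle).append (.cons hyw.symm
          (p.append (.cons hxw (A.mapLe hle))))).support =
          B.support ++ (p.support ++ A.support) := by
        simp [Walk.support_append_cons]
      refine ⟨x', y', hx', hy', hxy', (hrs x').1 (by simp [hAB]),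
        (B.mapLe hle).append (.cons hyw.symm (p.append (.cons hxw (A.mapLe hle)))),
        ?_, fun z => ?_⟩
      · rw [Walk.isPath_def] at hp hr ⊢
        rw [hsup]
        rw [hAB] at hr
        simp only [hAB] at hdisj
        simp only [List.nodup_append, List.mem_append] at hr hdisj ⊢
        refine ⟨hr.2.1, ⟨hp, hr.1, ?_⟩, ?_⟩
        · rintro z hz _ hz' rfl
          exact hdisj z hz (Or.inl hz')
        · rintro z hz _ (hz' | hz') rfl
          · exact hdisj z hz' (Or.inr hz)
          · exact hr.2.2 z hz' z hz rfl
      · have hz := hrs z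
        rw [hAB] at hz
        rw [hsup]
        simp only [List.mem_append, hps] at hz ⊢
        constructor
        · rintro (h | ⟨j, hj, h⟩ | h)
          · exact ⟨k + 1, le_rfl, hz.1 (Or.inr h)⟩
          · exact ⟨j, by omega, h⟩
          · exact ⟨k + 1, le_rfl, hz.1 (Or.inl h)⟩
        · rintro ⟨j, hj, h⟩
          rcases hj.lt_or_eq with hj | rfl
          · exact Or.inr (Or.inl ⟨j, by omega, h⟩)
          · rcases hz.2 h with h | h
            · exact Or.inr (Or.inr h)
            · exact Or.inl h
  have hpos : 0 < addOrderOf q := addOrderOf_pos q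
  obtain ⟨x, y, -, -, hxy, -, p, hp, hps⟩ := main (addOrderOf q - 1) (by omega)
  refine hp.isHamiltonian_of_adj hV (fun z => (hps z).2 ?_) (hle hxy)
  classical
  obtain ⟨j, hj, hjz⟩ := Finset.mem_image.1
    (mem_zmultiples_iff_mem_range_addOrderOf.1 (hq (lab z)))
  exact ⟨j, by have := Finset.mem_range.1 hj; omega, hjz.symm⟩

/-- An additive subgroup of `ZMod m` is closed under taking gcds of representatives. -/
lemma ZMod.natCast_gcd_mem {m : ℕ} {A : AddSubgroup (ZMod m)} {k l : ℕ} (hk : (k : ZMod m) ∈ A)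
    (hl : (l : ZMod m) ∈ A) : ((Nat.gcd k l : ℕ) : ZMod m) ∈ A := by
  have h := congrArg (Int.cast : ℤ → ZMod m) (Nat.gcd_eq_gcd_ab k l)
  push_cast at h
  rw [h, mul_comm (k : ZMod m), mul_comm (l : ZMod m), ← zsmul_eq_mul, ← zsmul_eq_mul]
  exact A.add_mem (A.zsmul_mem hk _) (A.zsmul_mem hl _)

/-- The index of a vertex of a bicirculant. -/
def vertexIndex {m : ℕ} : ZMod m ⊕ ZMod m → ZMod m := Sum.elim id id

/-- Translation of the vertices of a bicirculant. -/
def vertexShift {m : ℕ} (t : ZMod m) : ZMod m ⊕ ZMod m → ZMod m ⊕ ZMod m :=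
  Sum.map (· + t) (· + t)

lemma vertexShift_injective {m : ℕ} (t : ZMod m) : Function.Injective (vertexShift t) :=
  Sum.map_injective.2 ⟨add_left_injective t, add_left_injective t⟩

lemma vertexIndex_vertexShift {m : ℕ} (t : ZMod m) (x : ZMod m ⊕ ZMod m) :
    vertexIndex (vertexShift t x) = vertexIndex x + t := by
  cases x <;> rfl

section RoseWindow

variable {m : ℕ} {a b c : ZMod m}

lemma rwH_adj_inl_inl (ha : a ≠ 0) {i j : ZMod m} :
    (rwH m a b c).Adj (.inl i) (.inl j) ↔ j = i + a ∨ i = j + a := by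
  simp only [rwH, roseWindow, bicirculant, deleteEdges_adj, fromRel_adj]
  simp
  grind

lemma rwH_adj_inr_inr (hb : b ≠ 0) {i j : ZMod m} :
    (rwH m a b c).Adj (.inr i) (.inr j) ↔ j = i + b ∨ i = j + b := by
  simp only [rwH, roseWindow, bicirculant, deleteEdges_adj, fromRel_adj]
  simp
  grind

lemma rwH_adj_inl_inr (hc : c ≠ 0) {i j : ZMod m} :
    (rwH m a b c).Adj (.inl i) (.inr j) ↔ j = i := by
  simp only [rwH, roseWindow, bicirculant, deleteEdges_adj, fromRel_adj]
  simp
  grind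

lemma rwH_adj_inr_inl (hc : c ≠ 0) {i j : ZMod m} :
    (rwH m a b c).Adj (.inr i) (.inl j) ↔ i = j := by
  rw [adj_comm, rwH_adj_inl_inr hc]

lemma roseWindow_adj_spoke (i : ZMod m) :
    (roseWindow m a b c).Adj (.inl i) (.inr (i + c)) := by
  simp [roseWindow, bicirculant]

lemma rwH_le : rwH m a b c ≤ roseWindow m a b c := deleteEdges_le _

/-- Translation as an endomorphism of `H`. -/
def rwHShift (ha : a ≠ 0) (hb : b ≠ 0) (hc : c ≠ 0) (t : ZMod m) :
    rwH m a b c →g rwH m a b c where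
  toFun := vertexShift t
  map_rel' {x y} h := by
    rcases x with i | i <;> rcases y with j | j <;>
      simp only [vertexShift, Sum.map_inl, Sum.map_inr, rwH_adj_inl_inl ha, rwH_adj_inr_inr hb,
        rwH_adj_inl_inr hc, rwH_adj_inr_inl hc] at h ⊢ <;> grind

lemma rwH_reachable_of_mem_closure (ha : a ≠ 0) (hb : b ≠ 0) (hc : c ≠ 0) {g : ZMod m}
    (hg : g ∈ AddSubgroup.closure {a, b}) (i : ZMod m) :
    (rwH m a b c).Reachable (.inl i) (.inl (i + g)) := by
  induction hg using AddSubgroup.closure_induction generalizing i with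
  | mem x hx =>
    rcases hx with rfl | rfl
    · exact ((rwH_adj_inl_inl ha).2 (Or.inl rfl)).reachable
    · exact ((rwH_adj_inl_inr hc).2 rfl).reachable.trans
        (((rwH_adj_inr_inr hb).2 (Or.inl rfl)).reachable.trans
          ((rwH_adj_inr_inl hc).2 rfl).reachable)
  | zero => simp
  | add x y _ _ hx hy => simpa [add_assoc] using (hx i).trans (hy (i + x))
  | neg x _ hx => simpa using (hx (i + -x)).symm

lemma rwH_mk_eq_of_adj (ha : a ≠ 0) (hb : b ≠ 0) (hc : c ≠ 0) {x y : ZMod m ⊕ ZMod m}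
    (h : (rwH m a b c).Adj x y) :
    (vertexIndex x : ZMod m ⧸ AddSubgroup.closure {a, b}) = vertexIndex y := by
  have hA : a ∈ AddSubgroup.closure {a, b} := AddSubgroup.subset_closure (by simp)
  have hB : b ∈ AddSubgroup.closure {a, b} := AddSubgroup.subset_closure (by simp)
  rw [QuotientAddGroup.eq]
  rcases x with i | i <;> rcases y with j | j <;>
    simp only [vertexIndex, Sum.elim_inl, Sum.elim_inr, id, rwH_adj_inl_inl ha,
      rwH_adj_inr_inr hb, rwH_adj_inl_inr hc, rwH_adj_inr_inl hc] at h ⊢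
  · rcases h with rfl | rfl <;> simpa
  · simp [h]
  · simp [h]
  · rcases h with rfl | rfl <;> simpa

lemma mem_rwK_iff (ha : a ≠ 0) (hb : b ≠ 0) (hc : c ≠ 0) (x : ZMod m ⊕ ZMod m) :
    x ∈ rwK m a b c ↔ (vertexIndex x : ZMod m ⧸ AddSubgroup.closure {a, b}) = 0 := by
  rw [rwK, ConnectedComponent.mem_supp_iff, ConnectedComponent.eq]
  constructor
  · intro h
    have key : ∀ {x y : ZMod m ⊕ ZMod m}, (rwH m a b c).Walk x y →
        (vertexIndex x : ZMod m ⧸ AddSubgroup.closure {a, b}) = vertexIndex y := by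
      intro x y p
      induction p with
      | nil => rfl
      | cons h _ ih => rw [rwH_mk_eq_of_adj ha hb hc h, ih]
    exact h.elim key
  · intro h
    rw [QuotientAddGroup.eq_zero_iff] at h
    have h0 : (rwH m a b c).Reachable (.inl 0) (.inl (vertexIndex x)) := by
      simpa using rwH_reachable_of_mem_closure (c := c) ha hb hc h 0
    rcases x with i | i
    · exact h0.symm
    · exact ((rwH_adj_inr_inl hc).2 rfl).reachable.trans h0.symm

/-- The inclusion of `H_0` into `H`. -/
def rwH0Hom : rwH0 m a b c →g rwH m a b c where
  toFun := Subtype.val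
  map_rel' h := h

/-- A Hamilton path of `H_0` can be translated to any other component of `H`. -/
lemma exists_isPath_of_isHamiltonian (ha : a ≠ 0) (hb : b ≠ 0) (hc : c ≠ 0)
    {s t : rwK m a b c} {p : (rwH0 m a b c).Walk s t} (hp : p.IsHamiltonian) (r : ZMod m) :
    ∃ p' : (rwH m a b c).Walk (vertexShift r s) (vertexShift r t), p'.IsPath ∧
      ∀ z, z ∈ p'.support ↔
        (vertexIndex z : ZMod m ⧸ AddSubgroup.closure {a, b}) = r := by
  let f : rwH0 m a b c →g rwH m a b c := (rwHShift ha hb hc r).comp rwH0Hom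
  have hf : ∀ z, z ∈ (p.map f).support ↔ ∃ y ∈ p.support, f y = z := by simp
  refine ⟨p.map f, ?_, fun z => (hf z).trans ?_⟩
  · exact hp.isPath.map ((vertexShift_injective r).comp Subtype.val_injective)
  · constructor
    · rintro ⟨y, -, rfl⟩
      change (vertexIndex (vertexShift r (y : ZMod m ⊕ ZMod m)) :
        ZMod m ⧸ AddSubgroup.closure {a, b}) = r
      rw [vertexIndex_vertexShift, QuotientAddGroup.mk_add, (mem_rwK_iff ha hb hc _).1 y.2,
        zero_add]
    · intro hz
      refine ⟨⟨vertexShift (-r) z, ?_⟩, hp.mem_support _, ?_⟩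
      · rw [mem_rwK_iff ha hb hc, vertexIndex_vertexShift, QuotientAddGroup.mk_add, hz,
          ← QuotientAddGroup.mk_add, add_neg_cancel, QuotientAddGroup.mk_zero]
      · change vertexShift r (vertexShift (-r) z) = z
        cases z <;> simp [vertexShift]

lemma mem_zmultiples_mk [NeZero m]
    (hgcd : Nat.gcd m (Nat.gcd a.val (Nat.gcd b.val c.val)) = 1)
    (g : ZMod m ⧸ AddSubgroup.closure {a, b}) :
    g ∈ AddSubgroup.zmultiples (c : ZMod m ⧸ AddSubgroup.closure {a, b}) := by
  let B := (AddSubgroup.zmultiples (c : ZMod m ⧸ AddSubgroup.closure {a, b})).comap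
    (QuotientAddGroup.mk' _)
  have hle : AddSubgroup.closure {a, b} ≤ B := fun x hx => by
    change (x : ZMod m ⧸ AddSubgroup.closure {a, b}) ∈ AddSubgroup.zmultiples _
    rw [(QuotientAddGroup.eq_zero_iff x).2 hx]
    exact zero_mem _
  have haB : a ∈ B := hle (AddSubgroup.subset_closure (by simp))
  have hbB : b ∈ B := hle (AddSubgroup.subset_closure (by simp))
  have hcB : c ∈ B := AddSubgroup.mem_zmultiples _
  have h1 : ((Nat.gcd m (Nat.gcd a.val (Nat.gcd b.val c.val)) : ℕ) : ZMod m) ∈ B :=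
    ZMod.natCast_gcd_mem (by simp) (ZMod.natCast_gcd_mem (by simpa)
      (ZMod.natCast_gcd_mem (by simpa) (by simpa)))
  rw [hgcd, Nat.cast_one] at h1
  obtain ⟨z, rfl⟩ := QuotientAddGroup.mk_surjective g
  have hz : z ∈ B := by simpa using B.nsmul_mem h1 z.val
  exact hz

lemma exists_isCycle_of_isHamiltonian (ha : a ≠ 0) (hb : b ≠ 0) (hc : c ≠ 0)
    [Fintype (rwK m a b c)] (hham : (rwH0 m a b c).IsHamiltonian) {x : ZMod m ⊕ ZMod m}
    (hx : x ∈ rwK m a b c) :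
    ∃ p : (rwH m a b c).Walk x x, p.IsCycle ∧
      ∀ z, z ∈ p.support ↔ (vertexIndex z : ZMod m ⧸ AddSubgroup.closure {a, b}) = 0 := by
  classical
  have hl : Sum.inl 0 ∈ rwK m a b c := (mem_rwK_iff ha hb hc _).2 rfl
  have hr : Sum.inr 0 ∈ rwK m a b c := (mem_rwK_iff ha hb hc _).2 rfl
  have hcard : Fintype.card (rwK m a b c) ≠ 1 :=
    (Fintype.one_lt_card_iff.2 ⟨⟨_, hl⟩, ⟨_, hr⟩, by simp⟩).ne'
  obtain ⟨y, p, hp⟩ := hham hcard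
  have hp' := (Walk.isHamiltonianCycle_rotate (hp.mem_support ⟨x, hx⟩)).2 hp
  generalize p.rotate _ (hp.mem_support ⟨x, hx⟩) = p' at hp'
  have hf : ∀ z, z ∈ (p'.map rwH0Hom).support ↔ ∃ y ∈ p'.support, rwH0Hom y = z := by simp
  refine ⟨p'.map rwH0Hom, hp'.isCycle.map Subtype.val_injective, fun z => (hf z).trans ?_⟩
  rw [← mem_rwK_iff ha hb hc]
  constructor
  · rintro ⟨w, -, rfl⟩
    exact w.2
  · exact fun hz => ⟨⟨z, hz⟩, hp'.mem_support _, rfl⟩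

end RoseWindow

/-- The 2-hooked construction: if `gcd(m,a,b) > 1`, `H_0` is hamiltonian and has a
Hamilton path joining `v_x` and `v_{x+a}`, or joining `u_x` and `u_{x+b}`, for some
vertex `u_x` of `H_0`, then the connected `R(m;a,b,c)` is hamiltonian. -/
theorem roseWindow_two_hooked_construction (m : ℕ) [NeZero m] (hm : 3 ≤ m)
    (a b c : ZMod m) (ha : a ≠ 0) (hb : b ≠ 0) (hc : c ≠ 0)
    (ha2 : 2 * a ≠ 0) (hb2 : 2 * b ≠ 0)
    (hgcd : Nat.gcd m (Nat.gcd a.val (Nat.gcd b.val c.val)) = 1)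
    (hgcd2 : 1 < Nat.gcd m (Nat.gcd a.val b.val))
    [Fintype (rwK m a b c)]
    (hham : (rwH0 m a b c).IsHamiltonian)
    (hpath : ∃ (x : ZMod m), Sum.inl x ∈ rwK m a b c ∧
      ((∃ (h1 : Sum.inr x ∈ rwK m a b c) (h2 : Sum.inr (x + a) ∈ rwK m a b c)
          (p : (rwH0 m a b c).Walk ⟨Sum.inr x, h1⟩ ⟨Sum.inr (x + a), h2⟩),
          p.IsHamiltonian) ∨
       (∃ (h1 : Sum.inl x ∈ rwK m a b c) (h2 : Sum.inl (x + b) ∈ rwK m a b c)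
          (p : (rwH0 m a b c).Walk ⟨Sum.inl x, h1⟩ ⟨Sum.inl (x + b), h2⟩),
          p.IsHamiltonian))) :
    (roseWindow m a b c).IsHamiltonian := by
  classical
  have hV : 3 ≤ Fintype.card (ZMod m ⊕ ZMod m) := by
    rw [Fintype.card_sum, ZMod.card]; omega
  have hl : Sum.inl 0 ∈ rwK m a b c := (mem_rwK_iff ha hb hc _).2 rfl
  have hr : Sum.inr 0 ∈ rwK m a b c := (mem_rwK_iff ha hb hc _).2 rfl
  obtain ⟨x, -, ⟨h1, h2, p, hp⟩ | ⟨h1, h2, p, hp⟩⟩ := hpath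
  · have hook : ∀ i, ∃ q : (rwH m a b c).Walk (.inr (i + c)) (.inr (i + a + c)), q.IsPath ∧
        ∀ z, z ∈ q.support ↔ (vertexIndex z : ZMod m ⧸ AddSubgroup.closure {a, b}) = i + c := by
      intro i
      obtain ⟨q, hq, hqs⟩ := exists_isPath_of_isHamiltonian ha hb hc hp (i + c - x)
      have hx : (x : ZMod m ⧸ AddSubgroup.closure {a, b}) = 0 := (mem_rwK_iff ha hb hc _).1 h1
      have e : vertexShift (i + c - x) (.inr x) = .inr (i + c) := by
        simp [vertexShift]
      have e' : vertexShift (i + c - x) (.inr (x + a)) = .inr (i + a + c) := by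
        simp only [vertexShift, Sum.map_inr, Sum.inr.injEq]; ring
      exact ⟨q.copy e e', by simpa using hq, fun z => by simp [hqs, hx]⟩
    refine isHamiltonian_of_hooks hV rwH_le (col := fun x => x.isLeft = true)
      (lab := fun x => (vertexIndex x : ZMod m ⧸ AddSubgroup.closure {a, b}))
      (q := (c : ZMod m ⧸ _)) (mem_zmultiples_mk hgcd) ?_ ?_
      ⟨.inl 0, rfl, exists_isCycle_of_isHamiltonian ha hb hc hham hl⟩ ?_
    · rintro (i | i) (j | j) (k | k) <;> simp [rwH_adj_inl_inr hc]
      grind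
    · intro g
      obtain ⟨z, rfl⟩ := QuotientAddGroup.mk_surjective g
      exact ⟨.inl z, rfl, rfl⟩
    · rintro (i | i) (j | j) hi hj hij <;> simp at hi hj
      rcases (rwH_adj_inl_inl ha).1 hij with rfl | rfl
      · exact ⟨_, _, by simp, by simp, roseWindow_adj_spoke i, roseWindow_adj_spoke _, hook i⟩
      · obtain ⟨q, hq, hqs⟩ := hook j
        have hA : (a : ZMod m ⧸ AddSubgroup.closure {a, b}) = 0 :=
          (QuotientAddGroup.eq_zero_iff a).2 (AddSubgroup.subset_closure (by simp))
        refine ⟨_, _, by simp, by simp, roseWindow_adj_spoke _, roseWindow_adj_spoke _, q.reverse,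
          hq.reverse, fun z => ?_⟩
        simp [hqs, vertexIndex, hA]
  · have hook : ∀ i, ∃ q : (rwH m a b c).Walk (.inl (i - c)) (.inl (i + b - c)), q.IsPath ∧
        ∀ z, z ∈ q.support ↔ (vertexIndex z : ZMod m ⧸ AddSubgroup.closure {a, b}) = i + -c := by
      intro i
      obtain ⟨q, hq, hqs⟩ := exists_isPath_of_isHamiltonian ha hb hc hp (i - c - x)
      have hx : (x : ZMod m ⧸ AddSubgroup.closure {a, b}) = 0 := (mem_rwK_iff ha hb hc _).1 h1
      have e : vertexShift (i - c - x) (.inl x) = .inl (i - c) := by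
        simp [vertexShift]
      have e' : vertexShift (i - c - x) (.inl (x + b)) = .inl (i + b - c) := by
        simp only [vertexShift, Sum.map_inl, Sum.inl.injEq]; ring
      exact ⟨q.copy e e', by simpa using hq, fun z => by simp [hqs, hx, sub_eq_add_neg]⟩
    have spoke : ∀ i, (roseWindow m a b c).Adj (.inr i) (.inl (i - c)) := fun i => by
      simpa using (roseWindow_adj_spoke (a := a) (b := b) (c := c) (i - c)).symm
    refine isHamiltonian_of_hooks hV rwH_le (col := fun x => x.isRight = true)
      (lab := fun x => (vertexIndex x : ZMod m ⧸ AddSubgroup.closure {a, b}))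
      (q := -(c : ZMod m ⧸ _)) (fun g => ?_) ?_ ?_
      ⟨.inr 0, rfl, exists_isCycle_of_isHamiltonian ha hb hc hham hr⟩ ?_
    · rw [AddSubgroup.zmultiples_neg]
      exact mem_zmultiples_mk hgcd g
    · rintro (i | i) (j | j) (k | k) <;> simp [rwH_adj_inr_inl hc]
      grind
    · intro g
      obtain ⟨z, rfl⟩ := QuotientAddGroup.mk_surjective g
      exact ⟨.inr z, rfl, rfl⟩
    · rintro (i | i) (j | j) hi hj hij <;> simp at hi hj
      rcases (rwH_adj_inr_inr hb).1 hij with rfl | rfl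
      · exact ⟨_, _, by simp, by simp, spoke i, spoke _, hook i⟩
      · obtain ⟨q, hq, hqs⟩ := hook j
        have hB : (b : ZMod m ⧸ AddSubgroup.closure {a, b}) = 0 :=
          (QuotientAddGroup.eq_zero_iff b).2 (AddSubgroup.subset_closure (by simp))
        refine ⟨_, _, by simp, by simp, spoke _, spoke _, q.reverse, hq.reverse, fun z => ?_⟩
        simp [hqs, vertexIndex, hB]
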